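/- The downward refinement operator ρ_tf defined by the rewrite rules R0, R1, R2, R3, and R4 is locally finite and complete for the quasi-ordered set (G, ⊑→), where ⊑→ is trans-subsumption of directed labeled graphs. -/

import Mathlib

/-- A directed labeled graph (DLG) over a label type `L`, with vertices drawn from `ℕ`:
a finite vertex set `V`, a finite edge set `E ⊆ V × V`, and labeling functions for
vertices and edges. -/
structure DLG (L : Type) where
  V : Finset ℕ
  E : Finset (ℕ × ℕ)
  lv : ℕ → L
  le : ℕ × ℕ → L
  edge_mem : ∀ e ∈ E, e.1 ∈ V ∧ e.2 ∈ V

namespace DLG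

variable {L : Type}

/-- Undirected adjacency: there is an edge between `v` and `w` in either direction. -/
def adj (g : DLG L) (v w : ℕ) : Prop :=
  (v, w) ∈ g.E ∨ (w, v) ∈ g.E

/-- A DLG is connected when any two of its vertices are joined by an undirected path. -/
def Connected (g : DLG L) : Prop :=
  ∀ v ∈ g.V, ∀ w ∈ g.V, Relation.ReflTransGen g.adj v w

/-- A canonical fresh vertex not belonging to `g.V`. -/
def fresh (g : DLG L) : ℕ := g.V.sup id + 1

/-- The graph obtained by deleting the edge `e`. -/
def removeEdge (g : DLG L) (e : ℕ × ℕ) : DLG L where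
  V := g.V
  E := g.E.erase e
  lv := g.lv
  le := g.le
  edge_mem := fun e' he' => g.edge_mem e' (Finset.mem_of_mem_erase he')

/-- An edge `e ∈ E` is a bridge of `g` when removing it leaves a disconnected graph. -/
def IsBridge (g : DLG L) (e : ℕ × ℕ) : Prop :=
  e ∈ g.E ∧ ¬ (g.removeEdge e).Connected

/-- The set of edges of `g` incident to the vertex `v`. -/
def incident (g : DLG L) (v : ℕ) : Finset (ℕ × ℕ) :=
  g.E.filter fun e => e.1 = v ∨ e.2 = v

/-! ### Subsumption relations -/

/-- `m` witnesses that `g₁` subsumes `g₂` (regular subsumption). -/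
def SubsWith (g₁ g₂ : DLG L) (m : ℕ → ℕ) : Prop :=
  (∀ v ∈ g₁.V, m v ∈ g₂.V) ∧
  (∀ e ∈ g₁.E, (m e.1, m e.2) ∈ g₂.E) ∧
  (∀ v ∈ g₁.V, g₁.lv v = g₂.lv (m v)) ∧
  (∀ e ∈ g₁.E, g₁.le e = g₂.le (m e.1, m e.2))

/-- Regular subsumption `g₁ ⊑ g₂`. -/
def Subs (g₁ g₂ : DLG L) : Prop := ∃ m, SubsWith g₁ g₂ m

/-- The object-identity constraint on a vertex mapping: injectivity on `g₁.V`. -/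
def OI (g₁ : DLG L) (m : ℕ → ℕ) : Prop :=
  ∀ v₁ ∈ g₁.V, ∀ v₂ ∈ g₁.V, v₁ ≠ v₂ → m v₁ ≠ m v₂

/-- Regular subsumption under object identity. -/
def SubsOI (g₁ g₂ : DLG L) : Prop := ∃ m, SubsWith g₁ g₂ m ∧ OI g₁ m

/-- `m` and `me` witness that `g₁` trans-subsumes `g₂`: each edge of `g₁` is mapped to a
sequence of consecutive edges of `g₂` (given by the list of vertices `me e`), all carrying
the label of the original edge. -/
def TransSubsWith (g₁ g₂ : DLG L) (m : ℕ → ℕ) (me : ℕ × ℕ → List ℕ) : Prop :=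
  (∀ v ∈ g₁.V, m v ∈ g₂.V) ∧
  (∀ v ∈ g₁.V, g₁.lv v = g₂.lv (m v)) ∧
  (∀ e ∈ g₁.E,
    2 ≤ (me e).length ∧
    (me e).head? = some (m e.1) ∧
    (me e).getLast? = some (m e.2) ∧
    (me e).Chain' fun a b => (a, b) ∈ g₂.E ∧ g₂.le (a, b) = g₁.le e)

/-- Trans-subsumption `g₁ ⊑→ g₂`. -/
def TransSubs (g₁ g₂ : DLG L) : Prop := ∃ m me, TransSubsWith g₁ g₂ m me

/-- The object-identity constraint for trans-subsumption: `m` is injective on `g₁.V`, and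
no vertex of `g₁` other than the endpoints of an edge `e` of `g₁` is mapped into the
path `me e`. -/
def TransOI (g₁ : DLG L) (m : ℕ → ℕ) (me : ℕ × ℕ → List ℕ) : Prop :=
  OI g₁ m ∧ ∀ v ∈ g₁.V, ∀ e ∈ g₁.E, v ≠ e.1 → v ≠ e.2 → m v ∉ me e

/-- Trans-subsumption under object identity. -/
def TransSubsOI (g₁ g₂ : DLG L) : Prop :=
  ∃ m me, TransSubsWith g₁ g₂ m me ∧ TransOI g₁ m me

section OrderLabeled

variable [PartialOrder L]

/-- `m` witnesses subsumption relative to the partial order `≤` (i.e. `⪯`) on labels. -/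
def SubsPOWith (g₁ g₂ : DLG L) (m : ℕ → ℕ) : Prop :=
  (∀ v ∈ g₁.V, m v ∈ g₂.V) ∧
  (∀ e ∈ g₁.E, (m e.1, m e.2) ∈ g₂.E) ∧
  (∀ v ∈ g₁.V, g₁.lv v ≤ g₂.lv (m v)) ∧
  (∀ e ∈ g₁.E, g₁.le e ≤ g₂.le (m e.1, m e.2))

/-- Subsumption relative to `⪯`: `g₁ ⊑⪯ g₂`. -/
def SubsPO (g₁ g₂ : DLG L) : Prop := ∃ m, SubsPOWith g₁ g₂ m

/-- Subsumption relative to `⪯` under object identity. -/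
def SubsPOOI (g₁ g₂ : DLG L) : Prop := ∃ m, SubsPOWith g₁ g₂ m ∧ OI g₁ m

/-- `m` and `me` witness trans-subsumption relative to `⪯`. -/
def TransSubsPOWith (g₁ g₂ : DLG L) (m : ℕ → ℕ) (me : ℕ × ℕ → List ℕ) : Prop :=
  (∀ v ∈ g₁.V, m v ∈ g₂.V) ∧
  (∀ v ∈ g₁.V, g₁.lv v ≤ g₂.lv (m v)) ∧
  (∀ e ∈ g₁.E,
    2 ≤ (me e).length ∧
    (me e).head? = some (m e.1) ∧
    (me e).getLast? = some (m e.2) ∧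
    (me e).Chain' fun a b => (a, b) ∈ g₂.E ∧ g₁.le e ≤ g₂.le (a, b))

/-- Trans-subsumption relative to `⪯`: `g₁ ⊑→⪯ g₂`. -/
def TransSubsPO (g₁ g₂ : DLG L) : Prop := ∃ m me, TransSubsPOWith g₁ g₂ m me

/-- Trans-subsumption relative to `⪯` under object identity. -/
def TransSubsPOOI (g₁ g₂ : DLG L) : Prop :=
  ∃ m me, TransSubsPOWith g₁ g₂ m me ∧ TransOI g₁ m me

end OrderLabeled

/-! ### Refinement operators for flat-labeled DLGs -/

/-- The downward refinement operator `ρ_f`, given by rewrite rules R0, R1, R2, R3. -/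
def rho_f (g : DLG L) : Set (DLG L) :=
  {g' |
    -- R0: add a single vertex (labeled `a`) to the empty graph
    (g.V = ∅ ∧ g.E = ∅ ∧ ∃ a : L,
      g'.V = {g.fresh} ∧ g'.E = ∅ ∧
      g'.lv = Function.update g.lv g.fresh a ∧ g'.le = g.le) ∨
    -- R1: add a new vertex `v*` labeled `a` with outgoing edge `(v*, v₁)` labeled `b`
    (∃ v₁ ∈ g.V, ∃ a b : L,
      g'.V = insert g.fresh g.V ∧
      g'.E = insert (g.fresh, v₁) g.E ∧
      g'.lv = Function.update g.lv g.fresh a ∧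
      g'.le = Function.update g.le (g.fresh, v₁) b) ∨
    -- R2: add a new vertex `v*` labeled `a` with incoming edge `(v₁, v*)` labeled `b`
    (∃ v₁ ∈ g.V, ∃ a b : L,
      g'.V = insert g.fresh g.V ∧
      g'.E = insert (v₁, g.fresh) g.E ∧
      g'.lv = Function.update g.lv g.fresh a ∧
      g'.le = Function.update g.le (v₁, g.fresh) b) ∨
    -- R3: add an edge `(v₁, v₂)` labeled `a`
    (∃ v₁ ∈ g.V, ∃ v₂ ∈ g.V, (v₁, v₂) ∉ g.E ∧ ∃ a : L,
      g'.V = g.V ∧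
      g'.E = insert (v₁, v₂) g.E ∧
      g'.lv = g.lv ∧
      g'.le = Function.update g.le (v₁, v₂) a)}

/-- The downward refinement operator `ρ_tf`, given by rules R0–R3 together with the
split-edge rule R4. -/
def rho_tf (g : DLG L) : Set (DLG L) :=
  rho_f g ∪
  -- R4: split an edge `e` by a new vertex labeled `a`; both halves keep the label of `e`
  {g' | ∃ e ∈ g.E, ∃ a : L,
    g'.V = insert g.fresh g.V ∧
    g'.E = insert (e.1, g.fresh) (insert (g.fresh, e.2) (g.E.erase e)) ∧
    g'.lv = Function.update g.lv g.fresh a ∧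
    g'.le = Function.update (Function.update g.le (e.1, g.fresh) (g.le e))
      (g.fresh, e.2) (g.le e)}

/-- The upward refinement operator `γ_f`, given by rewrite rules UR0 and UR1. -/
def gamma_f (g : DLG L) : Set (DLG L) :=
  {g' |
    -- UR0: remove a non-bridge edge
    (∃ e ∈ g.E, ¬ g.IsBridge e ∧ g' = g.removeEdge e) ∨
    -- UR1: remove a vertex incident to at most one edge, with its incident edges
    (∃ v ∈ g.V, (g.incident v).card ≤ 1 ∧
      g'.V = g.V.erase v ∧ g'.E = g.E \ g.incident v ∧
      g'.lv = g.lv ∧ g'.le = g.le)}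

/-- The upward refinement operator `γ_tf`, given by rules UR0, UR1 together with the
shorten-edge rule UR2. -/
def gamma_tf (g : DLG L) : Set (DLG L) :=
  gamma_f g ∪
  -- UR2: replace edges `(v₁,v₂)`, `(v₂,v₃)` with the same label, where `v₂` has no other
  -- incident edges, by a single edge `(v₁,v₃)` with that label, deleting `v₂`
  {g' | ∃ v₁ v₂ v₃ : ℕ, (v₁, v₂) ∈ g.E ∧ (v₂, v₃) ∈ g.E ∧
    g.le (v₁, v₂) = g.le (v₂, v₃) ∧
    (∀ e ∈ g.E, e ≠ (v₁, v₂) → e.2 ≠ v₂) ∧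
    (∀ e ∈ g.E, e ≠ (v₂, v₃) → e.1 ≠ v₂) ∧
    g'.V = g.V.erase v₂ ∧
    g'.E = insert (v₁, v₃) ((g.E.erase (v₁, v₂)).erase (v₂, v₃)) ∧
    g'.lv = g.lv ∧
    g'.le = Function.update g.le (v₁, v₃) (g.le (v₁, v₂))}

/-! ### Refinement operators for order-labeled DLGs
Here the label set carries a partial order `≤` (standing for `⪯`) and `T` denotes the
distinguished most general label `⊤` (with `T ≤ a` for every label `a`). -/

section OrderLabeledOps

variable [PartialOrder L]

/-- The downward refinement operator `ρ_⪯`, given by rules R0PO–R5PO. -/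
def rhoPO (T : L) (g : DLG L) : Set (DLG L) :=
  {g' |
    -- R0PO: add a single vertex labeled ⊤ to the empty graph
    (g.V = ∅ ∧ g.E = ∅ ∧
      g'.V = {g.fresh} ∧ g'.E = ∅ ∧
      g'.lv = Function.update g.lv g.fresh T ∧ g'.le = g.le) ∨
    -- R1PO: add a new vertex `v*` labeled ⊤ and the edge `(v₁, v*)` labeled ⊤
    (∃ v₁ ∈ g.V,
      g'.V = insert g.fresh g.V ∧
      g'.E = insert (v₁, g.fresh) g.E ∧
      g'.lv = Function.update g.lv g.fresh T ∧
      g'.le = Function.update g.le (v₁, g.fresh) T) ∨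
    -- R2PO: add a new vertex `v*` labeled ⊤ and the edge `(v*, v₁)` labeled ⊤
    (∃ v₁ ∈ g.V,
      g'.V = insert g.fresh g.V ∧
      g'.E = insert (g.fresh, v₁) g.E ∧
      g'.lv = Function.update g.lv g.fresh T ∧
      g'.le = Function.update g.le (g.fresh, v₁) T) ∨
    -- R3PO: add an edge `(v₁, v₂)` labeled ⊤
    (∃ v₁ ∈ g.V, ∃ v₂ ∈ g.V, (v₁, v₂) ∉ g.E ∧
      g'.V = g.V ∧ g'.E = insert (v₁, v₂) g.E ∧
      g'.lv = g.lv ∧ g'.le = Function.update g.le (v₁, v₂) T) ∨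
    -- R4PO: refine a vertex label one step downwards in `⪯`
    (∃ v₁ ∈ g.V, ∃ b : L, g.lv v₁ < b ∧ (¬ ∃ c : L, g.lv v₁ < c ∧ c < b) ∧
      g'.V = g.V ∧ g'.E = g.E ∧
      g'.lv = Function.update g.lv v₁ b ∧ g'.le = g.le) ∨
    -- R5PO: refine an edge label one step downwards in `⪯`
    (∃ e ∈ g.E, ∃ b : L, g.le e < b ∧ (¬ ∃ c : L, g.le e < c ∧ c < b) ∧
      g'.V = g.V ∧ g'.E = g.E ∧
      g'.lv = g.lv ∧ g'.le = Function.update g.le e b)}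

/-- The downward refinement operator `ρ_t⪯`, given by rules R0PO–R5PO together with the
split-edge rule R6PO. -/
def rhoTPO (T : L) (g : DLG L) : Set (DLG L) :=
  rhoPO T g ∪
  -- R6PO: split an edge `e` by a new vertex labeled ⊤; both halves keep the label of `e`
  {g' | ∃ e ∈ g.E,
    g'.V = insert g.fresh g.V ∧
    g'.E = insert (e.1, g.fresh) (insert (g.fresh, e.2) (g.E.erase e)) ∧
    g'.lv = Function.update g.lv g.fresh T ∧
    g'.le = Function.update (Function.update g.le (e.1, g.fresh) (g.le e))
      (g.fresh, e.2) (g.le e)}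

/-- The upward refinement operator `γ_⪯`, given by rules UR0PO–UR3PO. -/
def gammaPO (T : L) (g : DLG L) : Set (DLG L) :=
  {g' |
    -- UR0PO: generalize a vertex label one step upwards in `⪯`
    (∃ v₁ ∈ g.V, ∃ b : L, b < g.lv v₁ ∧ (¬ ∃ c : L, b < c ∧ c < g.lv v₁) ∧
      g'.V = g.V ∧ g'.E = g.E ∧
      g'.lv = Function.update g.lv v₁ b ∧ g'.le = g.le) ∨
    -- UR1PO: generalize an edge label one step upwards in `⪯`
    (∃ e ∈ g.E, ∃ b : L, b < g.le e ∧ (¬ ∃ c : L, b < c ∧ c < g.le e) ∧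
      g'.V = g.V ∧ g'.E = g.E ∧
      g'.lv = g.lv ∧ g'.le = Function.update g.le e b) ∨
    -- UR2PO: remove a non-bridge edge labeled ⊤
    (∃ e ∈ g.E, g.le e = T ∧ ¬ g.IsBridge e ∧ g' = g.removeEdge e) ∨
    -- UR3PO: remove a vertex labeled ⊤ incident to at most one edge, all incident
    -- edges being labeled ⊤, together with those edges
    (∃ v ∈ g.V, g.lv v = T ∧ (g.incident v).card ≤ 1 ∧
      (∀ e ∈ g.incident v, g.le e = T) ∧
      g'.V = g.V.erase v ∧ g'.E = g.E \ g.incident v ∧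
      g'.lv = g.lv ∧ g'.le = g.le)}

/-- The upward refinement operator `γ_t⪯`, given by rules UR0PO–UR3PO together with the
shorten-edge rule UR4PO. -/
def gammaTPO (T : L) (g : DLG L) : Set (DLG L) :=
  gammaPO T g ∪
  -- UR4PO: as UR2, additionally requiring the removed middle vertex to be labeled ⊤
  {g' | ∃ v₁ v₂ v₃ : ℕ, (v₁, v₂) ∈ g.E ∧ (v₂, v₃) ∈ g.E ∧
    g.lv v₂ = T ∧
    g.le (v₁, v₂) = g.le (v₂, v₃) ∧
    (∀ e ∈ g.E, e ≠ (v₁, v₂) → e.2 ≠ v₂) ∧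
    (∀ e ∈ g.E, e ≠ (v₂, v₃) → e.1 ≠ v₂) ∧
    g'.V = g.V.erase v₂ ∧
    g'.E = insert (v₁, v₃) ((g.E.erase (v₁, v₂)).erase (v₂, v₃)) ∧
    g'.lv = g.lv ∧
    g'.le = Function.update g.le (v₁, v₃) (g.le (v₁, v₂))}

end OrderLabeledOps

/-- The cover of `g₁` over `g₂` via a mapping `m`: the subgraph of `g₂` consisting of the
vertices and edges referred to by `m`. -/
def cover (g₁ g₂ : DLG L) (m : ℕ → ℕ) : DLG L where
  V := g₁.V.image m
  E := g₁.E.image fun e => (m e.1, m e.2)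
  lv := g₂.lv
  le := g₂.le
  edge_mem := by
    intro e he
    simp only [Finset.mem_image] at he
    obtain ⟨e', he', rfl⟩ := he
    exact ⟨Finset.mem_image_of_mem m (g₁.edge_mem e' he').1,
      Finset.mem_image_of_mem m (g₁.edge_mem e' he').2⟩

end DLG

namespace DLG

variable {L : Type}

lemma exists_path_iff_transGen {α : Type*} {r : α → α → Prop} {a b : α} :
    (∃ l : List α, 2 ≤ l.length ∧ l.head? = some a ∧ l.getLast? = some b ∧ l.IsChain r) ↔
      Relation.TransGen r a b := by
  constructor
  · rintro ⟨l, hlen, hhead, hlast, hchain⟩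
    induction l generalizing a with
    | nil => simp at hlen
    | cons x l ih =>
      obtain rfl : x = a := by simpa using hhead
      cases l with
      | nil => simp at hlen
      | cons y l =>
        rw [List.isChain_cons_cons] at hchain
        cases l with
        | nil =>
          obtain rfl : y = b := by simpa using hlast
          exact .single hchain.1
        | cons z l =>
          exact .head hchain.1 (ih (by simp) (by simp) (by simpa using hlast) hchain.2)
  · intro h
    induction h using Relation.TransGen.head_induction_on with
    | @single a h => exact ⟨[a, b], by simp, by simp, by simp, by simpa using h⟩
    | @head a c h _ ih =>
      obtain ⟨l, hlen, hhead, hlast, hchain⟩ := ih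
      cases l with
      | nil => simp at hlen
      | cons y l =>
        obtain rfl : y = c := by simpa using hhead
        exact ⟨a :: y :: l, by simp, by simp, by simpa using hlast,
          List.isChain_cons_cons.2 ⟨h, hchain⟩⟩

/-- `m` witnesses trans-subsumption, with the paths replaced by the transitive closure of the
equally labeled edges. -/
structure IsTransHom (h g : DLG L) (m : ℕ → ℕ) : Prop where
  map_mem : ∀ v ∈ h.V, m v ∈ g.V
  map_label : ∀ v ∈ h.V, h.lv v = g.lv (m v)
  map_edge : ∀ e ∈ h.E,
    Relation.TransGen (fun a b => (a, b) ∈ g.E ∧ g.le (a, b) = h.le e) (m e.1) (m e.2)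

lemma transSubs_iff {h g : DLG L} : TransSubs h g ↔ ∃ m, IsTransHom h g m := by
  constructor
  · rintro ⟨m, me, h1, h2, h3⟩
    exact ⟨m, h1, h2, fun e he => exists_path_iff_transGen.1 ⟨me e, h3 e he⟩⟩
  · rintro ⟨m, h1, h2, h3⟩
    choose! me hme using fun e he => exists_path_iff_transGen.2 (h3 e he)
    exact ⟨m, me, h1, h2, hme⟩

/-- `m` is a trans-subsumption of `h` in `g`, and `c` is a section of `m` over the vertices in
`S`, such that every edge of `h` between vertices in `c '' S` comes from an edge of `g`. -/
structure IsPartialCopy (h g : DLG L) (S : Finset ℕ) (m c : ℕ → ℕ) : Prop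
    extends IsTransHom h g m where
  section_mem : ∀ s ∈ S, c s ∈ h.V
  map_section : ∀ s ∈ S, m (c s) = s
  section_edge : ∀ s ∈ S, ∀ t ∈ S, (c s, c t) ∈ h.E →
    (s, t) ∈ g.E ∧ h.le (c s, c t) = g.le (s, t)

lemma IsTransHom.isPartialCopy {h g : DLG L} {m : ℕ → ℕ} (hm : IsTransHom h g m)
    (c : ℕ → ℕ) : IsPartialCopy h g ∅ m c :=
  ⟨hm, by simp, by simp, by simp⟩

lemma fresh_notMem (g : DLG L) : g.fresh ∉ g.V := fun h =>
  Nat.not_succ_le_self _ (Finset.le_sup (f := id) h)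

/-- Attach a vertex `f` labeled `a` by an edge `e` labeled `b`. -/
def attach (h : DLG L) (f : ℕ) (e : ℕ × ℕ) (a b : L)
    (he : e.1 ∈ insert f h.V ∧ e.2 ∈ insert f h.V) : DLG L where
  V := insert f h.V
  E := insert e h.E
  lv := Function.update h.lv f a
  le := Function.update h.le e b
  edge_mem := by
    intro e' he'
    rcases Finset.mem_insert.1 he' with rfl | he'
    · exact he
    · exact ⟨Finset.mem_insert_of_mem (h.edge_mem e' he').1,
        Finset.mem_insert_of_mem (h.edge_mem e' he').2⟩

lemma IsPartialCopy.attach {h g : DLG L} {S : Finset ℕ} {m c : ℕ → ℕ}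
    (H : IsPartialCopy h g S m c) {f t : ℕ} (hf : f ∉ h.V) (ht : t ∈ g.V) (htS : t ∉ S)
    {e : ℕ × ℕ} (he : e.1 ∈ insert f h.V ∧ e.2 ∈ insert f h.V) (heE : e ∉ h.E)
    (heg : (Function.update m f t e.1, Function.update m f t e.2) ∈ g.E) :
    IsPartialCopy
      (h.attach f e (g.lv t) (g.le (Function.update m f t e.1, Function.update m f t e.2)) he)
      g (insert t S) (Function.update m f t) (Function.update c t f) := by
  have ne_f : ∀ v ∈ h.V, v ≠ f := fun v hv => by rintro rfl; exact hf hv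
  have ne_t : ∀ s ∈ S, s ≠ t := fun v hv => by rintro rfl; exact htS hv
  have section_map : ∀ s ∈ insert t S, Function.update m f t (Function.update c t f s) = s := by
    intro s hs
    rcases Finset.mem_insert.1 hs with rfl | hs
    · simp
    · rw [Function.update_of_ne (ne_t s hs), Function.update_of_ne (ne_f _ (H.section_mem s hs)),
        H.map_section s hs]
  refine ⟨⟨?_, ?_, ?_⟩, ?_, section_map, ?_⟩
  · intro v hv
    rcases Finset.mem_insert.1 hv with rfl | hv
    · simpa using ht
    · rw [Function.update_of_ne (ne_f v hv)]
      exact H.map_mem v hv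
  · intro v hv
    rcases Finset.mem_insert.1 hv with rfl | hv
    · simp [DLG.attach]
    · simp only [DLG.attach]
      rw [Function.update_of_ne (ne_f v hv), Function.update_of_ne (ne_f v hv)]
      exact H.map_label v hv
  · intro e' he'
    rcases Finset.mem_insert.1 he' with rfl | he'
    · exact .single ⟨heg, by simp [DLG.attach]⟩
    · have hne : e' ≠ e := fun heq => heE (heq ▸ he')
      simp only [DLG.attach]
      rw [Function.update_of_ne (ne_f _ (h.edge_mem e' he').1),
        Function.update_of_ne (ne_f _ (h.edge_mem e' he').2), Function.update_of_ne hne]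
      exact H.map_edge e' he'
  · intro s hs
    rcases Finset.mem_insert.1 hs with rfl | hs
    · simp [DLG.attach]
    · rw [Function.update_of_ne (ne_t s hs)]
      exact Finset.mem_insert_of_mem (H.section_mem s hs)
  · intro p hp q hq hpq
    rcases Finset.mem_insert.1 hpq with hpq | hpq
    · have h1 := section_map p hp
      have h2 := section_map q hq
      rw [hpq]
      subst hpq
      simp only [h1, h2] at heg ⊢
      exact ⟨heg, by simp [DLG.attach]⟩
    · have hp' : p ≠ t := by
        rintro rfl
        exact hf (by simpa using (h.edge_mem _ hpq).1)
      have hq' : q ≠ t := by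
        rintro rfl
        exact hf (by simpa using (h.edge_mem _ hpq).2)
      have hne : (Function.update c t f p, Function.update c t f q) ≠ e :=
        fun heq => heE (heq ▸ hpq)
      simp only [DLG.attach]
      rw [Function.update_of_ne hne]
      rw [Function.update_of_ne hp', Function.update_of_ne hq'] at hpq ⊢
      exact H.section_edge p (Finset.mem_of_mem_insert_of_ne hp hp') q
        (Finset.mem_of_mem_insert_of_ne hq hq') hpq

/-- A partial copy can be extended by a new vertex adjacent to the image of any vertex. -/
lemma IsPartialCopy.exists_insert {h g : DLG L} {S : Finset ℕ} {m c : ℕ → ℕ}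
    (H : IsPartialCopy h g S m c) {v t : ℕ} (hv : v ∈ h.V) (htS : t ∉ S)
    (hadj : g.adj (m v) t) :
    ∃ h' ∈ rho_tf h, ∃ m' c', IsPartialCopy h' g (insert t S) m' c' := by
  have hf := h.fresh_notMem
  have hvf : v ≠ h.fresh := by rintro rfl; exact hf hv
  rcases hadj with hadj | hadj
  · exact ⟨_, Or.inl (Or.inr (Or.inr (Or.inl ⟨v, hv, _, _, rfl, rfl, rfl, rfl⟩))), _, _,
      H.attach hf (g.edge_mem _ hadj).2 htS (e := (v, h.fresh)) (by simp [hv])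
        (fun h' => hf (h.edge_mem _ h').2) (by simpa [hvf] using hadj)⟩
  · exact ⟨_, Or.inl (Or.inr (Or.inl ⟨v, hv, _, _, rfl, rfl, rfl, rfl⟩)), _, _,
      H.attach hf (g.edge_mem _ hadj).1 htS (e := (h.fresh, v)) (by simp [hv])
        (fun h' => hf (h.edge_mem _ h').1) (by simpa [hvf] using hadj)⟩

/-- The boundary of a proper nonempty set of vertices of a connected graph is nonempty. -/
lemma Connected.exists_adj {g : DLG L} (hg : g.Connected) {S : Finset ℕ} {s t : ℕ}
    (hs : s ∈ S) (hsV : s ∈ g.V) (ht : t ∈ g.V) (htS : t ∉ S) :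
    ∃ p ∈ S, ∃ q, q ∉ S ∧ g.adj p q := by
  by_contra! hcon
  have : ∀ q, Relation.ReflTransGen g.adj s q → q ∈ S := by
    intro q hq
    induction hq with
    | refl => exact hs
    | tail _ h2 ih => exact by_contra fun hq => hcon _ ih _ hq h2
  exact htS (this t (hg s hsV t ht))

lemma adj_mem_right {g : DLG L} {p q : ℕ} (h : g.adj p q) : q ∈ g.V :=
  h.elim (fun h => (g.edge_mem _ h).2) (fun h => (g.edge_mem _ h).1)

lemma IsPartialCopy.exists_all_vertices {g : DLG L} (hg : g.Connected) {h : DLG L} {S : Finset ℕ}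
    {m c : ℕ → ℕ} (H : IsPartialCopy h g S m c) (hS : S.Nonempty) :
    ∃ h', Relation.ReflTransGen (fun x y => y ∈ rho_tf x) h h' ∧
      ∃ S' m' c', g.V ⊆ S' ∧ IsPartialCopy h' g S' m' c' := by
  induction hn : (g.V \ S).card using Nat.strong_induction_on generalizing h S m c with
  | _ n ih =>
  by_cases hsub : g.V ⊆ S
  · exact ⟨h, .refl, S, m, c, hsub, H⟩
  obtain ⟨t, ht, htS⟩ := Finset.not_subset.1 hsub
  obtain ⟨s, hs⟩ := hS
  have hsV : s ∈ g.V := H.map_section s hs ▸ H.map_mem _ (H.section_mem s hs)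
  obtain ⟨p, hp, q, hq, hpq⟩ := hg.exists_adj hs hsV ht htS
  obtain ⟨h', hh', m', c', H'⟩ := H.exists_insert (H.section_mem p hp) hq
    (by rwa [H.map_section p hp])
  have hlt : (g.V \ insert q S).card < n := by
    rw [← hn]
    refine Finset.card_lt_card (Finset.ssubset_iff_of_subset
      (Finset.sdiff_subset_sdiff subset_rfl (Finset.subset_insert q S)) |>.2 ⟨q, ?_, ?_⟩)
    · simp [hq, adj_mem_right hpq]
    · simp
  obtain ⟨h'', hr, hx⟩ := ih _ hlt H' (Finset.insert_nonempty q S) rfl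
  exact ⟨h'', .head hh' hr, hx⟩

lemma IsPartialCopy.exists_insert_edge {h g : DLG L} {S : Finset ℕ} {m c : ℕ → ℕ}
    (H : IsPartialCopy h g S m c) {e : ℕ × ℕ} (he : e ∈ g.E) (h1 : e.1 ∈ S) (h2 : e.2 ∈ S)
    (hnot : (c e.1, c e.2) ∉ h.E) :
    ∃ h' ∈ rho_tf h, IsPartialCopy h' g S m c ∧ h'.E = insert (c e.1, c e.2) h.E := by
  refine ⟨{ V := h.V, E := insert (c e.1, c e.2) h.E, lv := h.lv,
            le := Function.update h.le (c e.1, c e.2) (g.le e), edge_mem := ?_ },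
    Or.inl (Or.inr (Or.inr (Or.inr ⟨c e.1, H.section_mem _ h1, c e.2, H.section_mem _ h2, hnot,
      g.le e, rfl, rfl, rfl, rfl⟩))), ⟨⟨H.map_mem, H.map_label, ?_⟩, H.section_mem,
      H.map_section, ?_⟩, rfl⟩
  · intro e' he'
    rcases Finset.mem_insert.1 he' with rfl | he'
    · exact ⟨H.section_mem _ h1, H.section_mem _ h2⟩
    · exact h.edge_mem e' he'
  · intro e' he'
    rcases Finset.mem_insert.1 he' with rfl | he'
    · refine .single ?_
      simpa [H.map_section _ h1, H.map_section _ h2] using he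
    · have hne : e' ≠ (c e.1, c e.2) := by rintro rfl; exact hnot he'
      simp only [Function.update_of_ne hne]
      exact H.map_edge e' he'
  · intro p hp q hq hpq
    rcases Finset.mem_insert.1 hpq with hpq | hpq
    · obtain ⟨hcp, hcq⟩ := Prod.mk.inj hpq
      obtain rfl : p = e.1 := by
        rw [← H.map_section p hp, hcp, H.map_section _ h1]
      obtain rfl : q = e.2 := by
        rw [← H.map_section q hq, hcq, H.map_section _ h2]
      exact ⟨he, by simp⟩
    · have hne : (c p, c q) ≠ (c e.1, c e.2) := fun heq => hnot (heq ▸ hpq)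
      simp only [Function.update_of_ne hne]
      exact H.section_edge p hp q hq hpq

lemma IsPartialCopy.exists_edges {h g : DLG L} {S : Finset ℕ} {m c : ℕ → ℕ}
    (H : IsPartialCopy h g S m c) (hS : g.V ⊆ S) {T : Finset (ℕ × ℕ)} (hT : T ⊆ g.E) :
    ∃ h', Relation.ReflTransGen (fun x y => y ∈ rho_tf x) h h' ∧
      IsPartialCopy h' g S m c ∧ ∀ e ∈ T, (c e.1, c e.2) ∈ h'.E := by
  induction T using Finset.induction_on with
  | empty => exact ⟨h, .refl, H, by simp⟩
  | insert e T _ ih =>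
    obtain ⟨h', hr, H', hedge⟩ := ih ((Finset.subset_insert e T).trans hT)
    have he : e ∈ g.E := hT (Finset.mem_insert_self e T)
    by_cases hmem : (c e.1, c e.2) ∈ h'.E
    · refine ⟨h', hr, H', fun e' he' => ?_⟩
      rcases Finset.mem_insert.1 he' with rfl | he'
      exacts [hmem, hedge e' he']
    · obtain ⟨h'', hstep, H'', hE⟩ := H'.exists_insert_edge he (hS (g.edge_mem e he).1)
        (hS (g.edge_mem e he).2) hmem
      refine ⟨h'', hr.tail hstep, H'', fun e' he' => ?_⟩
      rw [hE]
      rcases Finset.mem_insert.1 he' with rfl | he'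
      exacts [Finset.mem_insert_self _ _, Finset.mem_insert_of_mem (hedge e' he')]

/-- A nonempty partial copy refines to a graph equivalent to the copied one. -/
lemma IsPartialCopy.exists_equivalent {g : DLG L} (hg : g.Connected) {h : DLG L} {S : Finset ℕ}
    {m c : ℕ → ℕ} (H : IsPartialCopy h g S m c) (hS : S.Nonempty) :
    ∃ h', Relation.ReflTransGen (fun x y => y ∈ rho_tf x) h h' ∧
      TransSubs h' g ∧ TransSubs g h' := by
  obtain ⟨h₁, hr₁, S', m', c', hS', H₁⟩ := H.exists_all_vertices hg hS
  obtain ⟨h₂, hr₂, H₂, hedge⟩ := H₁.exists_edges hS' subset_rfl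
  refine ⟨h₂, hr₁.trans hr₂, transSubs_iff.2 ⟨m', H₂.toIsTransHom⟩, transSubs_iff.2 ⟨c', ?_⟩⟩
  refine ⟨fun v hv => H₂.section_mem v (hS' hv), fun v hv => ?_, fun e he => ?_⟩
  · rw [H₂.map_label _ (H₂.section_mem v (hS' hv)), H₂.map_section v (hS' hv)]
  · exact .single ⟨hedge e he, (H₂.section_edge _ (hS' (g.edge_mem e he).1) _
      (hS' (g.edge_mem e he).2) (hedge e he)).2⟩

/-- If `h` trans-subsumes the connected graph `g` but not conversely, every vertex of `h` is mapped
to a vertex of `g` incident to some edge. -/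
lemma IsTransHom.exists_adj {h g : DLG L} {m : ℕ → ℕ} (hm : IsTransHom h g m)
    (hg : g.Connected) {v : ℕ} (hv : v ∈ h.V) (hnot : ¬ TransSubs g h) :
    ∃ t, g.adj (m v) t := by
  by_contra! hcon
  have hV : ∀ w ∈ g.V, w = m v := by
    intro w hw
    by_contra hne
    obtain ⟨p, hp, q, -, hpq⟩ := hg.exists_adj (Finset.mem_singleton_self (m v))
      (hm.map_mem v hv) hw (by simpa using hne)
    rw [Finset.mem_singleton.1 hp] at hpq
    exact hcon q hpq
  refine hnot (transSubs_iff.2 ⟨fun _ => v, fun _ _ => hv, fun w hw => ?_, fun e he => ?_⟩)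
  · rw [hV w hw, hm.map_label v hv]
  · exact absurd (Or.inl (hV _ (g.edge_mem e he).1 ▸ he)) (hcon e.2)

lemma eq_empty_of_V_eq_empty {g : DLG L} (hV : g.V = ∅) : g.E = ∅ :=
  Finset.eq_empty_of_forall_notMem fun e he => by simpa [hV] using (g.edge_mem e he).1

/-- The data of a graph, as a tuple. -/
def toTuple (g : DLG L) : Finset ℕ × Finset (ℕ × ℕ) × (ℕ → L) × (ℕ × ℕ → L) :=
  (g.V, g.E, g.lv, g.le)

lemma toTuple_injective : Function.Injective (toTuple (L := L)) := by
  rintro ⟨⟩ ⟨⟩ h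
  simp only [toTuple, Prod.mk.injEq] at h
  obtain ⟨rfl, rfl, rfl, rfl⟩ := h
  rfl

lemma finite_rho_tf [Finite L] (g : DLG L) : (rho_tf g).Finite := by
  refine Set.Finite.of_finite_image (f := toTuple) ?_ toTuple_injective.injOn
  let F0 : L → Finset ℕ × Finset (ℕ × ℕ) × (ℕ → L) × (ℕ × ℕ → L) := fun a =>
    ({g.fresh}, ∅, Function.update g.lv g.fresh a, g.le)
  let F1 : g.V × L × L → Finset ℕ × Finset (ℕ × ℕ) × (ℕ → L) × (ℕ × ℕ → L) := fun x =>
    (insert g.fresh g.V, insert (g.fresh, x.1.1) g.E, Function.update g.lv g.fresh x.2.1,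
      Function.update g.le (g.fresh, x.1.1) x.2.2)
  let F2 : g.V × L × L → Finset ℕ × Finset (ℕ × ℕ) × (ℕ → L) × (ℕ × ℕ → L) := fun x =>
    (insert g.fresh g.V, insert (x.1.1, g.fresh) g.E, Function.update g.lv g.fresh x.2.1,
      Function.update g.le (x.1.1, g.fresh) x.2.2)
  let F3 : g.V × g.V × L → Finset ℕ × Finset (ℕ × ℕ) × (ℕ → L) × (ℕ × ℕ → L) := fun x =>
    (g.V, insert (x.1.1, x.2.1.1) g.E, g.lv, Function.update g.le (x.1.1, x.2.1.1) x.2.2)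
  let F4 : g.E × L → Finset ℕ × Finset (ℕ × ℕ) × (ℕ → L) × (ℕ × ℕ → L) := fun x =>
    (insert g.fresh g.V,
      insert (x.1.1.1, g.fresh) (insert (g.fresh, x.1.1.2) (g.E.erase x.1.1)),
      Function.update g.lv g.fresh x.2,
      Function.update (Function.update g.le (x.1.1.1, g.fresh) (g.le x.1.1))
        (g.fresh, x.1.1.2) (g.le x.1.1))
  refine ((Set.finite_range F0).union ((Set.finite_range F1).union ((Set.finite_range F2).union
    ((Set.finite_range F3).union (Set.finite_range F4))))).subset ?_
  rintro _ ⟨g', hg', rfl⟩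
  rcases hg' with (⟨-, -, a, h1, h2, h3, h4⟩ | ⟨v, hv, a, b, h1, h2, h3, h4⟩ |
    ⟨v, hv, a, b, h1, h2, h3, h4⟩ | ⟨v, hv, w, hw, -, a, h1, h2, h3, h4⟩) |
    ⟨e, he, a, h1, h2, h3, h4⟩
  · exact Or.inl ⟨a, by simp only [F0, toTuple, h1, h2, h3, h4]⟩
  · exact Or.inr (Or.inl ⟨(⟨v, hv⟩, a, b), by simp only [F1, toTuple, h1, h2, h3, h4]⟩)
  · exact Or.inr (Or.inr (Or.inl ⟨(⟨v, hv⟩, a, b), by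
      simp only [F2, toTuple, h1, h2, h3, h4]⟩))
  · exact Or.inr (Or.inr (Or.inr (Or.inl ⟨(⟨v, hv⟩, ⟨w, hw⟩, a), by
      simp only [F3, toTuple, h1, h2, h3, h4]⟩)))
  · exact Or.inr (Or.inr (Or.inr (Or.inr ⟨(⟨e, he⟩, a), by
      simp only [F4, toTuple, h1, h2, h3, h4]⟩)))

/-- An empty graph refines to a single vertex copying a given vertex of `g`. -/
lemma exists_isPartialCopy_of_empty {h g : DLG L} (hV : h.V = ∅) {w : ℕ} (hw : w ∈ g.V) :
    ∃ h' ∈ rho_tf h, ∃ m c, IsPartialCopy h' g {w} m c := by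
  refine ⟨{ V := {h.fresh}, E := ∅, lv := Function.update h.lv h.fresh (g.lv w), le := h.le,
            edge_mem := by simp },
    Or.inl (Or.inl ⟨hV, eq_empty_of_V_eq_empty hV, g.lv w, rfl, rfl, rfl, rfl⟩),
    fun _ => w, fun _ => h.fresh, ⟨⟨?_, ?_, ?_⟩, ?_, ?_, ?_⟩⟩ <;> simp [hw]

end DLG

theorem rho_tf_locally_finite_and_complete {L : Type} [Fintype L] :
    -- locally finite
    (∀ g : DLG L, g.Connected → (DLG.rho_tf g).Finite) ∧
    -- complete: if g₁ strictly subsumes g₂, a finite chain of refinements starting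
    -- at g₁ reaches a graph equivalent to g₂
    (∀ g₁ g₂ : DLG L, g₁.Connected → g₂.Connected →
      DLG.TransSubs g₁ g₂ → ¬ DLG.TransSubs g₂ g₁ →
      ∃ h : DLG L, Relation.ReflTransGen (fun x y => y ∈ DLG.rho_tf x) g₁ h ∧
        DLG.TransSubs h g₂ ∧ DLG.TransSubs g₂ h) := by
  refine ⟨fun g _ => g.finite_rho_tf, fun g₁ g₂ _ hg₂ hsub hnot => ?_⟩
  obtain ⟨m, hm⟩ := DLG.transSubs_iff.1 hsub
  rcases g₁.V.eq_empty_or_nonempty with hV | ⟨v, hv⟩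
  · rcases g₂.V.eq_empty_or_nonempty with hV₂ | ⟨w, hw⟩
    · refine absurd (DLG.transSubs_iff.2 ⟨id, ?_⟩) hnot
      constructor <;> simp [hV₂, DLG.eq_empty_of_V_eq_empty hV₂]
    · obtain ⟨h, hh, m', c', H⟩ := DLG.exists_isPartialCopy_of_empty hV hw
      obtain ⟨h', hr, heq⟩ := H.exists_equivalent hg₂ (Finset.singleton_nonempty w)
      exact ⟨h', .head hh hr, heq⟩
  · obtain ⟨t, ht⟩ := hm.exists_adj hg₂ hv hnot
    obtain ⟨h, hh, m', c', H⟩ := (hm.isPartialCopy id).exists_insert hv (Finset.notMem_empty t) ht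
    obtain ⟨h', hr, heq⟩ := H.exists_equivalent hg₂ (Finset.insert_nonempty t ∅)
    exact ⟨h', .head hh hr, heq⟩
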